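/- With notation as in the setup: ℓ(w_a w_b) = ℓ(w_a) + ℓ(w_b); the element w_a is the minimal-length element of the coset w_a W_{S_b}; the product w_a w_b is the minimal-length element of the coset (w_a w_b) W_J; and supp(w_a) ∩ S_b ⊆ D^J(w_b). (That is, w_a w_b = w_a · w_b is a Billey–Postnikov decomposition with respect to S_b.) -/

import Mathlib

namespace CoxeterSystem

variable {B : Type*} {W : Type*} [Group W] {M : CoxeterMatrix B}

/-- The standard parabolic subgroup `W_T` of `W`, generated by the simple reflections
indexed by `T ⊆ B`. -/
def parabolic (cs : CoxeterSystem M W) (T : Set B) : Subgroup W :=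
  Subgroup.closure (cs.simple '' T)

/-- The Bruhat order on `W`: `u ≤ w` iff some reduced word for `w` contains a subword whose
product is `u`. -/
def bruhatLE (cs : CoxeterSystem M W) (u w : W) : Prop :=
  ∃ ω : List B, cs.IsReduced ω ∧ cs.wordProd ω = w ∧
    ∃ ω' : List B, ω'.Sublist ω ∧ cs.wordProd ω' = u

/-- `u` is the minimal-length representative `min (w W_T)` of the coset `w W_T`. -/
def IsMinRep (cs : CoxeterSystem M W) (T : Set B) (w u : W) : Prop :=
  w⁻¹ * u ∈ cs.parabolic T ∧
    ∀ v : W, w⁻¹ * v ∈ cs.parabolic T → cs.length u ≤ cs.length v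

/-- The Bruhat order on `W / W_T`: `u W_T ≤_T w W_T` iff `min (u W_T) ≤ min (w W_T)` in the
Bruhat order on `W`. -/
def bruhatLEQuot (cs : CoxeterSystem M W) (T : Set B) (u w : W) : Prop :=
  ∃ u' w' : W, cs.IsMinRep T u u' ∧ cs.IsMinRep T w w' ∧ cs.bruhatLE u' w'

/-- The support of `w`: the set of simple reflections occurring in some reduced word
for `w`. -/
def support (cs : CoxeterSystem M W) (w : W) : Set B :=
  {i | ∃ ω : List B, cs.IsReduced ω ∧ cs.wordProd ω = w ∧ i ∈ ω}

end CoxeterSystem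

namespace CoxeterSystem

open List

variable {B : Type*} {W : Type*} [Group W] {M : CoxeterMatrix B}

/-! ### The exchange property -/

section Exchange

open Classical in
/-- The action of the simple reflection `i` on `W × ZMod 2` which conjugates the first coordinate
by `i` and flips the second coordinate exactly at `i` itself. -/
noncomputable def signedConj (cs : CoxeterSystem M W) (i : B) : Function.End (W × ZMod 2) :=
  fun p => (cs.simple i * p.1 * cs.simple i, p.2 + if p.1 = cs.simple i then 1 else 0)

variable (cs : CoxeterSystem M W)

open Classical in
theorem prod_map_signedConj (ω : List B) (t : W) (ε : ZMod 2) :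
    (ω.map cs.signedConj).prod (t, ε) =
      (cs.wordProd ω * t * (cs.wordProd ω)⁻¹, ε + ((cs.rightInvSeq ω).count t : ZMod 2)) := by
  induction ω with
  | nil => exact Prod.ext (by simp [Function.End.one_def]) (by simp [Function.End.one_def])
  | cons i ω ih =>
    have h : cs.wordProd ω * t * (cs.wordProd ω)⁻¹ = cs.simple i ↔
        (cs.wordProd ω)⁻¹ * cs.simple i * cs.wordProd ω = t := by
      constructor
      · intro h
        rw [← h]
        group
      · rintro rfl
        group
    rw [map_cons, prod_cons]
    change cs.signedConj i ((ω.map cs.signedConj).prod (t, ε)) = _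
    rw [ih]
    simp only [signedConj, rightInvSeq, wordProd_cons, count_cons, h, beq_iff_eq]
    refine Prod.ext ?_ ?_
    · simp [mul_assoc]
    · simp only
      split_ifs <;> push_cast <;> ring

theorem rightInvSeq_eq_map_leftInvSeq (ω : List B) :
    cs.rightInvSeq ω = (cs.leftInvSeq ω).map (MulAut.conj (cs.wordProd ω)⁻¹) := by
  induction ω with
  | nil => simp [rightInvSeq, leftInvSeq]
  | cons i ω ih =>
    simp only [rightInvSeq, leftInvSeq, map_cons, map_map, ih, wordProd_cons]
    congr 1
    · simp [mul_assoc]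
    · refine map_congr_left fun t _ => ?_
      simp [mul_assoc]

theorem prod_map_alternatingWord {G : Type*} [Monoid G] (f : B → G) (i j : B) (m : ℕ) :
    ((alternatingWord i j (2 * m)).map f).prod = (f i * f j) ^ m := by
  induction m with
  | zero => simp [alternatingWord]
  | succ m ih =>
    rw [show 2 * (m + 1) = 2 * m + 1 + 1 by ring, alternatingWord_succ, alternatingWord_succ]
    simp [ih, pow_succ]

open Classical in
theorem even_count_leftInvSeq_alternatingWord (i j : B) (t : W) :
    Even ((cs.leftInvSeq (alternatingWord i j (2 * M i j))).count t) := by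
  set L := cs.leftInvSeq (alternatingWord i j (2 * M i j)) with hL
  have hlen : L.length = 2 * M i j := by simp [hL]
  have hdrop : L.drop (M i j) = L.take (M i j) := by
    refine ext_getElem (by simp [hlen]; lia) fun k h₁ h₂ => ?_
    simp only [length_take, hlen] at h₂
    rw [getElem_drop, getElem_take]
    simp only [hL]
    rw [getElem_leftInvSeq_alternatingWord _ _ _ _ _ (by lia),
      getElem_leftInvSeq_alternatingWord _ _ _ _ _ (by lia),
      prod_alternatingWord_eq_mul_pow, prod_alternatingWord_eq_mul_pow,
      show (2 * (M i j + k) + 1) / 2 = M j i + k by rw [M.symmetric i j]; lia,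
      show (2 * k + 1) / 2 = k by lia, pow_add, simple_mul_simple_pow, one_mul]
    simp
  rw [← take_append_drop (M i j) L, count_append, hdrop]
  exact Even.add_self _

theorem isLiftable_signedConj : M.IsLiftable cs.signedConj := by
  classical
  intro i j
  have hprod : cs.wordProd (alternatingWord i j (2 * M i j)) = 1 := by
    rw [wordProd, prod_map_alternatingWord, simple_mul_simple_pow]
  rw [← prod_map_alternatingWord]
  funext ⟨t, ε⟩
  rw [prod_map_signedConj, rightInvSeq_eq_map_leftInvSeq, hprod]
  have h := (ZMod.natCast_eq_zero_iff_even).2 (cs.even_count_leftInvSeq_alternatingWord i j t)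
  simp [h, Function.End.one_def]

open Classical in
/-- The parity of the multiplicity of `t` in the right inversion sequence of a word depends only
on the product of the word. -/
theorem count_rightInvSeq_eq_of_wordProd_eq {ω ω' : List B}
    (h : cs.wordProd ω = cs.wordProd ω') (t : W) :
    ((cs.rightInvSeq ω).count t : ZMod 2) = (cs.rightInvSeq ω').count t := by
  have key (ω : List B) : cs.lift ⟨_, cs.isLiftable_signedConj⟩ (cs.wordProd ω) =
      (ω.map cs.signedConj).prod := by
    rw [wordProd, map_list_prod, map_map]
    congr 1
    refine map_congr_left fun i _ => ?_
    exact cs.lift_apply_simple _ i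
  have h' : (ω.map cs.signedConj).prod (t, 0) = (ω'.map cs.signedConj).prod (t, 0) := by
    rw [← key, ← key, h]
  rw [prod_map_signedConj, prod_map_signedConj] at h'
  simpa using congrArg Prod.snd h'

theorem IsRightDescent.simple_mem_rightInvSeq {cs : CoxeterSystem M W} {ω : List B} {i : B}
    (h : cs.IsRightDescent (cs.wordProd ω) i) : cs.simple i ∈ cs.rightInvSeq ω := by
  classical
  obtain ⟨ω', hω', hw⟩ := cs.exists_isReduced (cs.wordProd ω * cs.simple i)
  have hprod : cs.wordProd ω = cs.wordProd (ω'.concat i) := by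
    rw [wordProd_concat, ← hw]
    simp
  have hnot : cs.simple i ∉ cs.rightInvSeq ω' := by
    intro hmem
    have := (cs.isRightInversion_of_mem_rightInvSeq hω' hmem).2
    rw [← hw] at this
    simp only [simple_mul_simple_cancel_right] at this
    exact absurd h (not_lt.2 this.le)
  have hnot' : cs.simple i ∉ (cs.rightInvSeq ω').map (MulAut.conj (cs.simple i)) := by
    intro hmem
    obtain ⟨t, ht, hti⟩ := mem_map.1 hmem
    have : t = cs.simple i := by
      have := congrArg (fun x => cs.simple i * x * cs.simple i) hti
      simpa [mul_assoc] using this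
    exact hnot (this ▸ ht)
  have hcount := cs.count_rightInvSeq_eq_of_wordProd_eq hprod (cs.simple i)
  rw [rightInvSeq_concat, concat_eq_append, count_append, count_eq_zero_of_not_mem hnot'] at hcount
  by_contra hmem
  rw [count_eq_zero_of_not_mem hmem] at hcount
  simp at hcount

/-- The exchange property. -/
theorem IsRightDescent.exists_eraseIdx {cs : CoxeterSystem M W} {ω : List B} {i : B}
    (h : cs.IsRightDescent (cs.wordProd ω) i) :
    ∃ j < ω.length, cs.wordProd ω * cs.simple i = cs.wordProd (ω.eraseIdx j) := by
  obtain ⟨j, hj, hji⟩ := mem_iff_getElem.1 h.simple_mem_rightInvSeq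
  refine ⟨j, by simpa using hj, ?_⟩
  rw [← wordProd_mul_getD_rightInvSeq, getD_eq_getElem _ _ hj, hji]

end Exchange

/-! ### The geometric representation -/

section GeometricRepresentation

open Polynomial Polynomial.Chebyshev

/-- The linear form `v ↦ 2 ⟨e_i, v⟩` of the geometric representation. -/
noncomputable def geomCoroot (M : CoxeterMatrix B) (i : B) : Module.Dual ℝ (B →₀ ℝ) :=
  Finsupp.linearCombination ℝ fun j => -2 * Real.cos (Real.pi / M i j)

theorem geomCoroot_single (M : CoxeterMatrix B) (i j : B) :
    geomCoroot M i (Finsupp.single j 1) = -2 * Real.cos (Real.pi / M i j) := by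
  simp [geomCoroot]

theorem geomCoroot_single_self (M : CoxeterMatrix B) (i : B) :
    geomCoroot M i (Finsupp.single i 1) = 2 := by
  simp [geomCoroot_single]

/-- The reflection by which the simple reflection `i` acts in the geometric representation. -/
noncomputable def geomReflection (M : CoxeterMatrix B) (i : B) :
    (B →₀ ℝ) ≃ₗ[ℝ] (B →₀ ℝ) :=
  Module.reflection (geomCoroot_single_self M i)

theorem S_eval_mul_sin_eq {m : ℕ} (n : ℤ) :
    (S ℝ n).eval (2 * Real.cos (2 * Real.pi / m)) * Real.sin (2 * Real.pi / m) =
      Real.sin ((n + 1) * (2 * Real.pi / m)) :=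
  S_two_mul_real_cos _ _

theorem isLiftable_geomReflection (M : CoxeterMatrix B) : M.IsLiftable (geomReflection M) := by
  intro i j
  rcases eq_or_ne i j with rfl | hij
  · rw [M.diagonal, pow_one]
    ext1 v
    exact Module.involutive_reflection (geomCoroot_single_self M i) v
  have ht : 2 * Real.cos (2 * Real.pi / M i j) =
      geomCoroot M i (Finsupp.single j 1) * geomCoroot M j (Finsupp.single i 1) - 2 := by
    rw [geomCoroot_single, geomCoroot_single, M.symmetric j i, mul_div_assoc, Real.cos_two_mul]
    ring
  ext1 z
  refine (Module.reflection_mul_reflection_pow_apply (geomCoroot_single_self M i)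
    (geomCoroot_single_self M j) (M i j) z _ ht).trans ?_
  have hm1 : M i j ≠ 1 := M.off_diagonal i j hij
  have hij0 : M i j = M j i := M.symmetric i j
  rw [show (1 : (B →₀ ℝ) ≃ₗ[ℝ] (B →₀ ℝ)) z = z from rfl]
  rcases Nat.lt_or_ge (M i j) 3 with hlt | hge
  · obtain h | h : M i j = 0 ∨ M i j = 2 := by lia
    · simp [h]
    · have hf : geomCoroot M i (Finsupp.single j 1) = 0 := by simp [geomCoroot_single, h]
      have hg : geomCoroot M j (Finsupp.single i 1) = 0 := by
        simp [geomCoroot_single, ← hij0, h]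
      simp [h, hf, hg]
      module
  · generalize M i j = m at hge
    have hm : (m : ℝ) ≠ 0 := by positivity
    have hm3 : (3 : ℝ) ≤ m := by exact_mod_cast hge
    have hsin : Real.sin (2 * Real.pi / m) ≠ 0 := by
      refine (Real.sin_pos_of_pos_of_lt_pi (by positivity) ?_).ne'
      rw [div_lt_iff₀ (by positivity)]
      nlinarith [Real.pi_pos]
    set t := 2 * Real.cos (2 * Real.pi / m)
    rcases Nat.even_or_odd' m with ⟨k, rfl | rfl⟩
    · have h0 : (S ℝ ((k : ℤ) - 1)).eval t = 0 := by
        refine (mul_eq_zero.1 ?_).resolve_right hsin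
        rw [S_eval_mul_sin_eq]
        convert Real.sin_pi using 2
        have hk : (k : ℝ) ≠ 0 := by simpa using hm
        push_cast
        field_simp
        ring
      rw [show (((2 * k : ℕ) : ℤ) - 2) / 2 = k - 1 by lia,
        show (((2 * k : ℕ) : ℤ) - 1) / 2 = k - 1 by lia, h0]
      simp
    · have h0 : (S ℝ (k : ℤ)).eval t + (S ℝ ((k : ℤ) - 1)).eval t = 0 := by
        refine (mul_eq_zero.1 ?_).resolve_right hsin
        rw [add_mul, S_eval_mul_sin_eq, S_eval_mul_sin_eq]
        have : (((k : ℤ) - 1 : ℤ) + 1 : ℝ) * (2 * Real.pi / (2 * k + 1 : ℕ)) =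
            2 * Real.pi - (((k : ℤ) : ℝ) + 1) * (2 * Real.pi / (2 * k + 1 : ℕ)) := by
          push_cast at hm ⊢
          field_simp
          ring
        rw [this, Real.sin_two_pi_sub]
        ring
      rw [show (((2 * k + 1 : ℕ) : ℤ) - 2) / 2 = k - 1 by lia,
        show (((2 * k + 1 : ℕ) : ℤ) - 1) / 2 = k by lia,
        show (((2 * k + 1 : ℕ) : ℤ) - 3) / 2 = k - 1 by lia,
        show (((2 * k + 1 : ℕ) : ℤ)) / 2 = k by lia, h0]
      simp

theorem simple_injective (cs : CoxeterSystem M W) : Function.Injective cs.simple := by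
  intro i j h
  by_contra hij
  have h' : geomReflection M i = geomReflection M j := by
    rw [← cs.lift_apply_simple (isLiftable_geomReflection M) i, h,
      cs.lift_apply_simple (isLiftable_geomReflection M) j]
  have := DFunLike.congr_fun (DFunLike.congr_fun h' (Finsupp.single i 1)) i
  simp [geomReflection, Module.reflection_apply, hij] at this
  norm_num at this

end GeometricRepresentation

/-! ### Parabolic subgroups and minimal coset representatives -/

section Parabolic

variable {cs : CoxeterSystem M W} {T : Set B}

theorem simple_mem_parabolic {i : B} (hi : i ∈ T) : cs.simple i ∈ cs.parabolic T :=
  Subgroup.subset_closure ⟨i, hi, rfl⟩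

theorem wordProd_mem_parabolic {ω : List B} (hω : ∀ i ∈ ω, i ∈ T) :
    cs.wordProd ω ∈ cs.parabolic T := by
  refine Subgroup.list_prod_mem _ fun x hx => ?_
  obtain ⟨i, hi, rfl⟩ := mem_map.1 hx
  exact simple_mem_parabolic (hω i hi)

theorem exists_isReduced_of_mem_parabolic {w : W} (hw : w ∈ cs.parabolic T) :
    ∃ ω : List B, cs.IsReduced ω ∧ (∀ i ∈ ω, i ∈ T) ∧ cs.wordProd ω = w := by
  have step (x : W) (i : B) (hi : i ∈ T)
      (hx : ∃ ω : List B, cs.IsReduced ω ∧ (∀ i ∈ ω, i ∈ T) ∧ cs.wordProd ω = x) :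
      ∃ ω : List B, cs.IsReduced ω ∧ (∀ i ∈ ω, i ∈ T) ∧ cs.wordProd ω = x * cs.simple i := by
    obtain ⟨ω, hω, hωT, rfl⟩ := hx
    by_cases hd : cs.IsRightDescent (cs.wordProd ω) i
    · obtain ⟨j, hj, hji⟩ := hd.exists_eraseIdx
      refine ⟨ω.eraseIdx j, ?_, fun c hc => hωT c ((eraseIdx_sublist ω j).subset hc), hji.symm⟩
      have h := cs.isRightDescent_iff.1 hd
      rw [hω.eq] at h
      have h₂ := length_eraseIdx_add_one hj
      rw [IsReduced, ← hji]
      lia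
    · refine ⟨ω.concat i, ?_, ?_, cs.wordProd_concat i ω⟩
      · rw [IsReduced, wordProd_concat, cs.not_isRightDescent_iff.1 hd, hω.eq, length_concat]
      · intro c hc
        rw [concat_eq_append, mem_append, mem_singleton] at hc
        rcases hc with hc | rfl
        · exact hωT c hc
        · exact hi
  induction hw using Subgroup.closure_induction_right with
  | one => exact ⟨[], by simp [IsReduced], by simp, by simp⟩
  | mul_right x _ y hy ih =>
    obtain ⟨i, hi, rfl⟩ := hy
    exact step x i hi ih
  | mul_inv_cancel x _ y hy ih =>
    obtain ⟨i, hi, rfl⟩ := hy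
    rw [inv_simple]
    exact step x i hi ih

theorem simple_mem_parabolic_iff {i : B} : cs.simple i ∈ cs.parabolic T ↔ i ∈ T := by
  refine ⟨fun h => ?_, simple_mem_parabolic⟩
  obtain ⟨ω, hω, hωT, hprod⟩ := exists_isReduced_of_mem_parabolic h
  have hlen := hω.eq
  rw [hprod, length_simple] at hlen
  obtain ⟨c, rfl⟩ := List.length_eq_one_iff.1 hlen.symm
  rw [wordProd_singleton] at hprod
  rw [← cs.simple_injective hprod]
  exact hωT c mem_cons_self

theorem mem_of_isRightDescent_of_mem_parabolic {w : W} {i : B} (hw : w ∈ cs.parabolic T)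
    (hi : cs.IsRightDescent w i) : i ∈ T := by
  obtain ⟨ω, -, hωT, rfl⟩ := exists_isReduced_of_mem_parabolic hw
  obtain ⟨j, -, hji⟩ := hi.exists_eraseIdx
  refine simple_mem_parabolic_iff.1 ((Subgroup.mul_mem_cancel_left (cs.parabolic T) hw).1 ?_)
  rw [hji]
  exact wordProd_mem_parabolic fun c hc => hωT c ((eraseIdx_sublist ω j).subset hc)

theorem isMinRep_self_iff {u : W} :
    cs.IsMinRep T u u ↔ ∀ x ∈ cs.parabolic T, cs.length u ≤ cs.length (u * x) := by
  refine ⟨fun h x hx => h.2 _ (by simpa using hx), fun h => ⟨by simp [one_mem], fun v hv => ?_⟩⟩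
  simpa using h _ hv

theorem IsMinRep.congr_left {w w' u : W} (h : cs.IsMinRep T w u)
    (hw : w'⁻¹ * w ∈ cs.parabolic T) : cs.IsMinRep T w' u := by
  refine ⟨?_, fun v hv => h.2 v ?_⟩
  · simpa [mul_assoc] using mul_mem hw h.1
  · simpa [mul_assoc] using mul_mem (inv_mem hw) hv

theorem IsMinRep.not_isRightDescent {u : W} {i : B} (h : cs.IsMinRep T u u) (hi : i ∈ T) :
    ¬cs.IsRightDescent u i :=
  not_lt.2 (isMinRep_self_iff.1 h _ (simple_mem_parabolic hi))

theorem exists_isMinRep (cs : CoxeterSystem M W) (T : Set B) (w : W) :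
    ∃ u, cs.IsMinRep T w u := by
  obtain ⟨u, hu, hmin⟩ := (measure cs.length).wf.has_min {u | w⁻¹ * u ∈ cs.parabolic T}
    ⟨w, by simp [one_mem]⟩
  exact ⟨u, hu, fun v hv => not_lt.1 (hmin v hv)⟩

/-- Lengths add in the parabolic factorization of an element. -/
theorem IsMinRep.length_mul {u v : W} (hu : cs.IsMinRep T u u) (hv : v ∈ cs.parabolic T) :
    cs.length (u * v) = cs.length u + cs.length v := by
  obtain ⟨ω, hω, hωT, rfl⟩ := exists_isReduced_of_mem_parabolic hv
  clear hv
  induction ω using List.reverseRecOn with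
  | nil => simp
  | append_singleton ω i ih =>
    have hred : cs.IsReduced ω := by simpa using hω.take ω.length
    have hωT' : ∀ c ∈ ω, c ∈ T := fun c hc => hωT c (mem_append_left _ hc)
    have hi : i ∈ T := hωT i (by simp)
    have ih := ih hred hωT'
    have hlen := hω.eq
    rw [wordProd_append, wordProd_singleton, length_append, length_singleton] at hlen
    rw [wordProd_append, wordProd_singleton, ← mul_assoc, hlen]
    rw [hred.eq] at ih
    suffices h : ¬cs.IsRightDescent (u * cs.wordProd ω) i by
      rw [cs.not_isRightDescent_iff.1 h, ih, add_assoc]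
    intro hd
    obtain ⟨ν, hν, rfl⟩ := cs.exists_isReduced u
    rw [← wordProd_append] at hd
    obtain ⟨j, hj, hji⟩ := hd.exists_eraseIdx
    rcases Nat.lt_or_ge j ν.length with hjν | hjν
    · rw [eraseIdx_append_of_lt_length hjν, wordProd_append, wordProd_append] at hji
      have hle := hu.2 (cs.wordProd (ν.eraseIdx j)) (by
        rw [← mul_inv_eq_iff_eq_mul] at hji
        have hmem := wordProd_mem_parabolic (cs := cs) hωT'
        have hsi := simple_mem_parabolic (cs := cs) hi
        have : (cs.wordProd ν)⁻¹ * cs.wordProd (ν.eraseIdx j) =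
            cs.wordProd ω * cs.simple i * (cs.wordProd ω)⁻¹ := by
          rw [← hji]
          simp [mul_assoc]
        rw [this]
        exact mul_mem (mul_mem hmem hsi) (inv_mem hmem))
      have h₁ := cs.length_wordProd_le (ν.eraseIdx j)
      have h₂ := length_eraseIdx_add_one hjν
      rw [hν.eq] at hle
      lia
    · rw [eraseIdx_append_of_length_le hjν, wordProd_append, wordProd_append, mul_assoc,
        mul_left_cancel_iff] at hji
      rw [length_append] at hj
      have h₁ := cs.length_wordProd_le (ω.eraseIdx (j - ν.length))
      have h₂ := length_eraseIdx_add_one (show j - ν.length < ω.length by lia)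
      rw [hji] at hlen
      lia

theorem isMinRep_self_of_forall_not_isRightDescent {u : W}
    (h : ∀ i ∈ T, ¬cs.IsRightDescent u i) : cs.IsMinRep T u u := by
  obtain ⟨v, hv⟩ := cs.exists_isMinRep T u
  have hvv : cs.IsMinRep T v v :=
    hv.congr_left (by simpa using inv_mem hv.1)
  obtain ⟨x, hx, rfl⟩ : ∃ x ∈ cs.parabolic T, u = v * x :=
    ⟨v⁻¹ * u, by simpa using inv_mem hv.1, by simp⟩
  rcases eq_or_ne x 1 with rfl | hne
  · simpa using hvv
  obtain ⟨i, hi⟩ := cs.exists_rightDescent_of_ne_one hne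
  have hiT := mem_of_isRightDescent_of_mem_parabolic hx hi
  refine absurd ?_ (h i hiT)
  have hlt : cs.length (x * cs.simple i) < cs.length x := hi
  rw [IsRightDescent, mul_assoc, hvv.length_mul hx,
    hvv.length_mul (mul_mem hx (simple_mem_parabolic hiT))]
  lia

theorem bruhatLE_refl (cs : CoxeterSystem M W) (w : W) : cs.bruhatLE w w := by
  obtain ⟨ω, hω, rfl⟩ := cs.exists_isReduced w
  exact ⟨ω, hω, rfl, ω, Sublist.refl ω, rfl⟩

theorem IsLeftDescent.bruhatLE {w : W} {i : B} (h : cs.IsLeftDescent w i) :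
    cs.bruhatLE (cs.simple i * w) w := by
  obtain ⟨ω, hω, hprod⟩ := cs.exists_isReduced (cs.simple i * w)
  have hw : cs.wordProd (i :: ω) = w := by
    rw [wordProd_cons, ← hprod, simple_mul_simple_cancel_left]
  refine ⟨i :: ω, ?_, hw, ω, sublist_cons_self i ω, hprod.symm⟩
  rw [IsReduced, hw, ← cs.isLeftDescent_iff.1 h, hprod, hω.eq, length_cons]

theorem IsMinRep.simple_mul {w : W} {i : B} (hw : cs.IsMinRep T w w)
    (h : cs.IsLeftDescent w i) : cs.IsMinRep T (cs.simple i * w) (cs.simple i * w) := by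
  refine isMinRep_self_iff.2 fun x hx => ?_
  have h₁ := isMinRep_self_iff.1 hw x hx
  have h₂ := cs.isLeftDescent_iff.1 h
  have h₃ := cs.length_simple_mul (w * x) i
  rw [mul_assoc]
  lia

/-- Deodhar's lemma: if `w` is minimal in its coset and `s w` is longer than `w` but not minimal
in its coset, then `s w` lies in the coset of `w`. -/
theorem IsMinRep.inv_simple_mul_mul_mem_of_not_isMinRep {w : W} {i : B} (hw : cs.IsMinRep T w w)
    (h : ¬cs.IsMinRep T (cs.simple i * w) (cs.simple i * w)) :
    (cs.simple i * w)⁻¹ * w ∈ cs.parabolic T := by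
  obtain ⟨c, hc, hd⟩ : ∃ c ∈ T, cs.IsRightDescent (cs.simple i * w) c := by
    by_contra! hcon
    exact h (isMinRep_self_of_forall_not_isRightDescent hcon)
  have hwc := hw.not_isRightDescent hc
  obtain ⟨ω, hω, rfl⟩ := cs.exists_isReduced w
  rw [← wordProd_cons] at hd ⊢
  obtain ⟨j, hj, hji⟩ := hd.exists_eraseIdx
  cases j with
  | zero =>
    rw [eraseIdx_cons_zero] at hji
    rw [← hji, inv_mul_cancel_left]
    exact simple_mem_parabolic hc
  | succ k =>
    rw [eraseIdx_cons_succ, wordProd_cons, wordProd_cons, mul_assoc, mul_left_cancel_iff] at hji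
    have h₁ := cs.length_wordProd_le (ω.eraseIdx k)
    have h₂ := length_eraseIdx_add_one (show k < ω.length by simpa using hj)
    refine absurd ?_ hwc
    rw [IsRightDescent, hji, hω.eq]
    lia

end Parabolic

end CoxeterSystem

/-- With `a ≠ b` in `B`, `S_a = S \ {a}`, `S_b = S \ {b}`, `J = S \ {a, b}`, and `w_a`, `w_b`
the maximal-length elements of `W_{S_a}^J` and `W_{S_b}^J` (assumed finite parabolics):
`ℓ(w_a w_b) = ℓ(w_a) + ℓ(w_b)`; `w_a` is minimal in the coset `w_a W_{S_b}`; `w_a w_b` is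
minimal in the coset `(w_a w_b) W_J`; and `supp(w_a) ∩ S_b ⊆ D^J(w_b)`.  That is,
`w_a w_b` is a Billey–Postnikov decomposition with respect to `S_b`. -/
theorem billey_postnikov_decomposition
    {B : Type*} {W : Type*} [Group W] {M : CoxeterMatrix B} (cs : CoxeterSystem M W)
    (a b : B) (hab : a ≠ b)
    (hfina : (↑(cs.parabolic {a}ᶜ) : Set W).Finite)
    (hfinb : (↑(cs.parabolic {b}ᶜ) : Set W).Finite)
    (wa : W) (hwa_mem : wa ∈ cs.parabolic {a}ᶜ)
    (hwa_min : cs.IsMinRep ({a, b}ᶜ) wa wa)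
    (hwa_max : ∀ v ∈ cs.parabolic {a}ᶜ, cs.IsMinRep ({a, b}ᶜ) v v →
      cs.length v ≤ cs.length wa)
    (wb : W) (hwb_mem : wb ∈ cs.parabolic {b}ᶜ)
    (hwb_min : cs.IsMinRep ({a, b}ᶜ) wb wb)
    (hwb_max : ∀ v ∈ cs.parabolic {b}ᶜ, cs.IsMinRep ({a, b}ᶜ) v v →
      cs.length v ≤ cs.length wb) :
    cs.length (wa * wb) = cs.length wa + cs.length wb ∧
    cs.IsMinRep ({b}ᶜ) wa wa ∧
    cs.IsMinRep ({a, b}ᶜ) (wa * wb) (wa * wb) ∧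
    (∀ i ∈ cs.support wa, i ≠ b →
      cs.bruhatLEQuot ({a, b}ᶜ) (cs.simple i * wb) wb) := by
  have hJb : cs.parabolic ({a, b}ᶜ) ≤ cs.parabolic {b}ᶜ :=
    Subgroup.closure_mono (Set.image_mono (Set.compl_subset_compl.2 (by simp)))
  have hwa : cs.IsMinRep ({b}ᶜ) wa wa := by
    refine CoxeterSystem.isMinRep_self_of_forall_not_isRightDescent fun i hi hd => ?_
    have hia := CoxeterSystem.mem_of_isRightDescent_of_mem_parabolic hwa_mem hd
    exact hwa_min.not_isRightDescent (by simp_all) hd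
  refine ⟨hwa.length_mul hwb_mem, hwa, ?_, fun i _ hib => ?_⟩
  · refine CoxeterSystem.isMinRep_self_iff.2 fun x hx => ?_
    rw [mul_assoc, hwa.length_mul hwb_mem, hwa.length_mul (mul_mem hwb_mem (hJb hx))]
    exact Nat.add_le_add_left (CoxeterSystem.isMinRep_self_iff.1 hwb_min x hx) _
  · by_cases hd : cs.IsLeftDescent wb i
    · exact ⟨_, wb, hwb_min.simple_mul hd, hwb_min, hd.bruhatLE⟩
    · have hnot : ¬cs.IsMinRep ({a, b}ᶜ) (cs.simple i * wb) (cs.simple i * wb) := by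
        intro hmin
        have hle := hwb_max _
          (mul_mem (CoxeterSystem.simple_mem_parabolic (by simpa using hib)) hwb_mem) hmin
        rw [cs.not_isLeftDescent_iff.1 hd] at hle
        lia
      exact ⟨wb, wb, hwb_min.congr_left (hwb_min.inv_simple_mul_mul_mem_of_not_isMinRep hnot),
        hwb_min, cs.bruhatLE_refl wb⟩
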